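/- Let y ∈ {0, 1/2, 1}^m be a half-integral vector that is an extreme point of the fractional matroid parity polytope P. Then the matrix B(y) has full column rank (i.e., rank B(y) = 4|y|). -/

import Mathlib

open Matrix

noncomputable section

/-- Wedge product `a ∧ b = a bᵀ − b aᵀ`. -/
def wedge {K : Type*} [Field K] {n : ℕ} (a b : Fin n → K) : Matrix (Fin n) (Fin n) K :=
  vecMulVec a b - vecMulVec b a

/-- The line spanned by `a` and `b`. -/
def line {K : Type*} [Field K] {n : ℕ} (a b : Fin n → K) : Submodule K (Fin n → K) :=
  Submodule.span K {a, b}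

/-- `y` is a fractional matroid matching for the lines `ℓᵢ = span {aᵢ, bᵢ}`. -/
def IsFracMatching {K : Type*} [Field K] {n m : ℕ} (a b : Fin m → Fin n → K)
    (y : Fin m → ℝ) : Prop :=
  (∀ i, 0 ≤ y i) ∧ ∀ S : Submodule K (Fin n → K),
    ∑ i, (Module.finrank K ↥(S ⊓ line (a i) (b i)) : ℝ) * y i ≤ (Module.finrank K ↥S : ℝ)

/-- The rational function field generated over `K` by the entries of the `2 × 2`
indeterminate matrices `U₁, …, U_m`. -/
abbrev FF2 (K : Type*) [Field K] (m : ℕ) : Type _ :=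
  FractionRing (MvPolynomial (Fin m × Fin 2 × Fin 2) K)

/-- The indeterminate `(Uᵢ)_{p,c}` as an element of `FF2 K m`. -/
def Uvar {K : Type*} [Field K] {m : ℕ} (i : Fin m) (p c : Fin 2) : FF2 K m :=
  algebraMap (MvPolynomial (Fin m × Fin 2 × Fin 2) K) (FF2 K m) (MvPolynomial.X (i, p, c))

def toFF2 (K : Type*) [Field K] (m : ℕ) : K →+* FF2 K m :=
  (algebraMap (MvPolynomial (Fin m × Fin 2 × Fin 2) K) (FF2 K m)).comp MvPolynomial.C

/-- The `n × 2` matrix `Bᵢ = [aᵢ bᵢ]`. -/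
def colMat {K : Type*} [Field K] {n : ℕ} (a b : Fin n → K) : Matrix (Fin n) (Fin 2) K :=
  Matrix.of fun r j => if j = 0 then a r else b r

/-- The matrix `B(z) = [U₁ ⊗ B₁ ⋯ U_m ⊗ B_m]`, where the half-integral vector `z` is
encoded by `s : Fin m → ℕ` with `sᵢ = 2 zᵢ ∈ {0, 1, 2}`, and `Uᵢ` is a `2 × sᵢ` matrix of
distinct indeterminates.  The unused columns (those with `c ≥ sᵢ`) are padded with zeros,
so that `B(z)` has full column rank iff this matrix has rank `∑ᵢ 2 sᵢ = 4|z|`. -/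
def Bmat {K : Type*} [Field K] {n m : ℕ} (a b : Fin m → Fin n → K) (s : Fin m → ℕ) :
    Matrix (Fin 2 × Fin n) (Fin m × Fin 2 × Fin 2) (FF2 K m) :=
  Matrix.of fun pr icj =>
    if (icj.2.1 : ℕ) < s icj.1 then
      Uvar icj.1 pr.1 icj.2.1 * toFF2 K m (colMat (a icj.1) (b icj.1) pr.2 icj.2.2)
    else 0

/-- The `2 × 2` matrix `Yᵢ = Uᵢ Uᵢᵀ`, where `Uᵢ` is a `2 × sᵢ` matrix of indeterminates. -/
def Ymat {K : Type*} [Field K] {m : ℕ} (s : Fin m → ℕ) (i : Fin m) :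
    Matrix (Fin 2) (Fin 2) (FF2 K m) :=
  Matrix.of fun p q => ∑ c : Fin 2, if (c : ℕ) < s i then Uvar i p c * Uvar i q c else 0

/-- The matrix `A^{(2)}(y) = ∑ᵢ (Uᵢ Uᵢᵀ) ⊗ (aᵢ ∧ bᵢ)`, where the half-integral vector `y`
is encoded by `t : Fin m → ℕ` with `tᵢ = 2 yᵢ ∈ {0, 1, 2}`. -/
def A2 {K : Type*} [Field K] {n m : ℕ} (a b : Fin m → Fin n → K) (t : Fin m → ℕ) :
    Matrix (Fin 2 × Fin n) (Fin 2 × Fin n) (FF2 K m) :=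
  ∑ i : Fin m,
    kroneckerMap (· * ·) (Ymat t i) ((wedge (a i) (b i)).map (toFF2 K m))
open Module Submodule

section LinearAlgebra

variable {K V W : Type*} [Field K] [AddCommGroup V] [Module K V] [AddCommGroup W] [Module K W]

theorem finrank_map_add_finrank_inf_ker [FiniteDimensional K V] (φ : V →ₗ[K] W)
    (S : Submodule K V) :
    finrank K (S.map φ) + finrank K ↥(S ⊓ LinearMap.ker φ) = finrank K S := by
  have h := LinearMap.finrank_range_add_finrank_ker (φ.domRestrict S)
  rw [LinearMap.range_domRestrict, LinearMap.ker_domRestrict] at h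
  rw [← h]
  congr 1
  rw [← Submodule.finrank_map_subtype_eq S (comap S.subtype (LinearMap.ker φ)),
    Submodule.map_comap_subtype]

theorem finrank_inf_add_finrank_inf_le [FiniteDimensional K V] (S T L : Submodule K V) :
    finrank K ↥(S ⊓ L) + finrank K ↥(T ⊓ L) ≤
      finrank K ↥((S ⊔ T) ⊓ L) + finrank K ↥((S ⊓ T) ⊓ L) := by
  rw [← Submodule.finrank_sup_add_finrank_inf_eq (S ⊓ L) (T ⊓ L)]
  gcongr
  · exact Submodule.finrank_mono (sup_le (inf_le_inf_right _ le_sup_left)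
      (inf_le_inf_right _ le_sup_right))
  · exact Submodule.finrank_mono (by rw [← inf_inf_distrib_right])

theorem finrank_sup_span_singleton_of_notMem [FiniteDimensional K V] {M : Submodule K V} {v : V}
    (hv : v ∉ M) : finrank K ↥(M ⊔ span K {v}) = finrank K M + 1 := by
  apply le_antisymm
  · have h := Submodule.finrank_add_le_finrank_add_finrank M (span K {v})
    have h' := finrank_span_singleton (K := K) (v := v) (fun h0 => hv (h0 ▸ M.zero_mem))
    omega
  · apply Submodule.finrank_lt_finrank_of_lt
    refine lt_of_le_of_ne le_sup_left fun h => hv ?_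
    rw [h]
    exact mem_sup_right (mem_span_singleton_self v)

theorem finrank_lt_of_mem [FiniteDimensional K V] {S T : Submodule K V} {v : V} (h : S ≤ T)
    (hT : v ∈ T) (hS : v ∉ S) : finrank K S + 1 ≤ finrank K T :=
  Submodule.finrank_lt_finrank_of_lt (lt_of_le_of_ne h fun h' => hS (h' ▸ hT))

theorem finrank_inf_sup_span_singleton_le [FiniteDimensional K V] (T M : Submodule K V) (v : V) :
    finrank K ↥(T ⊓ (M ⊔ span K {v})) ≤ finrank K ↥(T ⊓ M) + 1 := by
  have h1 := Submodule.finrank_sup_add_finrank_inf_eq T (M ⊔ span K {v})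
  have h2 := Submodule.finrank_sup_add_finrank_inf_eq T M
  have h3 := Submodule.finrank_add_le_finrank_add_finrank M (span K {v})
  have h4 := finrank_span_le_card (R := K) ({v} : Set V)
  have h5 : finrank K ↥(T ⊔ M) ≤ finrank K ↥(T ⊔ (M ⊔ span K {v})) :=
    Submodule.finrank_mono (sup_le_sup_left le_sup_left _)
  simp at h4
  omega

theorem mem_sup_of_finrank_inf_lt [FiniteDimensional K V] {T M : Submodule K V} {v : V}
    (h : finrank K ↥(T ⊓ M) < finrank K ↥(T ⊓ (M ⊔ span K {v}))) : v ∈ T ⊔ M := by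
  by_contra hv
  refine h.not_ge (Submodule.finrank_mono fun x hx => ⟨hx.1, ?_⟩)
  obtain ⟨m, hm, z, hz, rfl⟩ := mem_sup.1 hx.2
  obtain ⟨k, rfl⟩ := mem_span_singleton.1 hz
  rcases eq_or_ne k 0 with rfl | hk
  · simpa using hm
  · refine absurd ?_ hv
    have : k • v ∈ T ⊔ M := by
      have : k • v = (m + k • v) - m := by abel
      rw [this]
      exact sub_mem (mem_sup_left hx.1) (mem_sup_right hm)
    exact (Submodule.smul_mem_iff _ hk).1 this

variable {ι : Type*} [DecidableEq ι]

open Classical in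
theorem exists_tight_of_not_extend [FiniteDimensional K V] (v : ι → V) {e : ι} {E : Finset ι}
    (he : e ∉ E) (M₀ M₁ : Submodule K V)
    (h : ∀ T : Submodule K V, ((insert e E).filter fun x => v x ∈ T).card +
      finrank K ↥(T ⊓ M₀) + finrank K ↥(T ⊓ M₁) ≤ 2 * finrank K T)
    (hne : ¬ (v e ∉ M₀ ∧ ∀ T : Submodule K V, (E.filter fun x => v x ∈ T).card +
      finrank K ↥(T ⊓ (M₀ ⊔ span K {v e})) + finrank K ↥(T ⊓ M₁) ≤ 2 * finrank K T)) :
    ∃ T : Submodule K V, v e ∉ T ∧ v e ∈ T ⊔ M₀ ∧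
      2 * finrank K T ≤ (E.filter fun x => v x ∈ T).card +
        finrank K ↥(T ⊓ M₀) + finrank K ↥(T ⊓ M₁) := by
  have h0 : v e ≠ 0 := by
    intro h0
    have := h ⊥
    simp [Finset.filter_insert, h0] at this
  by_cases hM : v e ∈ M₀
  · exact ⟨⊥, by simpa using h0, by simpa using hM, by simp⟩
  · push Not at hne
    obtain ⟨T, hT⟩ := hne hM
    have h1 := finrank_inf_sup_span_singleton_le T M₀ (v e)
    have h2 := h T
    rw [Finset.filter_insert] at h2
    by_cases hvT : v e ∈ T
    · rw [if_pos hvT, Finset.card_insert_of_notMem (by simp [he])] at h2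
      omega
    · rw [if_neg hvT] at h2
      exact ⟨T, hvT, mem_sup_of_finrank_inf_lt (by omega), by omega⟩

open Classical in
theorem card_filter_mem_add_le (v : ι → V) (E : Finset ι) (S T : Submodule K V) :
    (E.filter fun x => v x ∈ S).card + (E.filter fun x => v x ∈ T).card ≤
      (E.filter fun x => v x ∈ S ⊔ T).card + (E.filter fun x => v x ∈ S ⊓ T).card := by
  rw [← Finset.card_union_add_card_inter]
  gcongr
  · intro x
    simp only [Finset.mem_union, Finset.mem_filter]
    rintro (⟨h1, h2⟩ | ⟨h1, h2⟩)
    · exact ⟨h1, mem_sup_left h2⟩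
    · exact ⟨h1, mem_sup_right h2⟩
  · intro x
    simp only [Finset.mem_inter, Finset.mem_filter]
    rintro ⟨⟨h1, h2⟩, -, h3⟩
    exact ⟨h1, h2, h3⟩

open Classical in
/-- If no subspace is overfull, then one of the two contracting subspaces can be enlarged by a
given vector. -/
theorem extend_left_or_right [FiniteDimensional K V] (v : ι → V) {e : ι} {E : Finset ι}
    (he : e ∉ E) (M₀ M₁ : Submodule K V)
    (h : ∀ T : Submodule K V, ((insert e E).filter fun x => v x ∈ T).card +
      finrank K ↥(T ⊓ M₀) + finrank K ↥(T ⊓ M₁) ≤ 2 * finrank K T) :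
    (v e ∉ M₀ ∧ ∀ T : Submodule K V, (E.filter fun x => v x ∈ T).card +
      finrank K ↥(T ⊓ (M₀ ⊔ span K {v e})) + finrank K ↥(T ⊓ M₁) ≤ 2 * finrank K T) ∨
    (v e ∉ M₁ ∧ ∀ T : Submodule K V, (E.filter fun x => v x ∈ T).card +
      finrank K ↥(T ⊓ M₀) + finrank K ↥(T ⊓ (M₁ ⊔ span K {v e})) ≤ 2 * finrank K T) := by
  by_contra hcon
  rw [not_or] at hcon
  obtain ⟨S, hS, hSM, hS2⟩ := exists_tight_of_not_extend v he M₀ M₁ h hcon.1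
  obtain ⟨T, hT, hTM, hT2⟩ := exists_tight_of_not_extend v he M₁ M₀
    (fun T => by have := h T; omega)
    (fun hc => hcon.2 ⟨hc.1, fun T => by have := hc.2 T; omega⟩)
  have c0 := finrank_inf_add_finrank_inf_le S T M₀
  have c1 := finrank_inf_add_finrank_inf_le S T M₁
  have c2 := card_filter_mem_add_le v E S T
  have c3 := Submodule.finrank_sup_add_finrank_inf_eq S T
  have hI := h (S ⊓ T)
  rw [Finset.filter_insert, if_neg (fun hc => hS hc.1)] at hI
  by_cases hv : v e ∈ S ⊔ T
  · have hU := h (S ⊔ T)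
    rw [Finset.filter_insert, if_pos hv, Finset.card_insert_of_notMem (by simp [he])] at hU
    omega
  · have hmem : v e ∈ S ⊔ T ⊔ span K {v e} := mem_sup_right (mem_span_singleton_self _)
    have hU := h (S ⊔ T ⊔ span K {v e})
    rw [Finset.filter_insert, if_pos hmem,
      Finset.card_insert_of_notMem (by simp [he]), finrank_sup_span_singleton_of_notMem hv] at hU
    have c4 : (E.filter fun x => v x ∈ S ⊔ T).card ≤
        (E.filter fun x => v x ∈ S ⊔ T ⊔ span K {v e}).card := by
      refine Finset.card_le_card fun x => ?_
      simp only [Finset.mem_filter]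
      exact fun hx => ⟨hx.1, mem_sup_left hx.2⟩
    have key : ∀ S' M : Submodule K V, S' ≤ S ⊔ T → v e ∈ S' ⊔ M →
        finrank K ↥((S ⊔ T) ⊓ M) + 1 ≤ finrank K ↥((S ⊔ T ⊔ span K {v e}) ⊓ M) := by
      intro S' M hS' hvM
      obtain ⟨s, hs, m, hm, hsm⟩ := mem_sup.1 hvM
      have hm' : m = v e - s := by rw [← hsm]; abel
      refine finrank_lt_of_mem (v := m) (inf_le_inf_right _ le_sup_left) ⟨?_, hm⟩ ?_
      · rw [hm']
        exact sub_mem hmem (mem_sup_left (hS' hs))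
      · intro hc
        apply hv
        rw [← hsm]
        exact add_mem (hS' hs) hc.1
    have k0 := key S M₀ le_sup_left hSM
    have k1 := key T M₁ le_sup_right hTM
    omega

open Classical in
/-- Matroid partition of vectors into a set independent modulo `M₀` and a set independent
modulo `M₁`. -/
theorem exists_partition [FiniteDimensional K V] (v : ι → V) (E : Finset ι)
    (M₀ M₁ : Submodule K V)
    (h : ∀ T : Submodule K V, (E.filter fun x => v x ∈ T).card +
      finrank K ↥(T ⊓ M₀) + finrank K ↥(T ⊓ M₁) ≤ 2 * finrank K T) :
    ∃ g : ι → Fin 2, finrank K M₀ + finrank K M₁ + E.card ≤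
      finrank K ↥(M₀ ⊔ span K (v '' {e | e ∈ E ∧ g e = 0})) +
      finrank K ↥(M₁ ⊔ span K (v '' {e | e ∈ E ∧ g e = 1})) := by
  induction E using Finset.induction_on generalizing M₀ M₁ with
  | empty =>
    refine ⟨fun _ => 0, ?_⟩
    rw [Finset.card_empty, add_zero]
    exact add_le_add (Submodule.finrank_mono le_sup_left) (Submodule.finrank_mono le_sup_left)
  | insert e E he ih =>
    have key : ∀ (M : Submodule K V) (g : ι → Fin 2) (r : Fin 2),
        M ⊔ span K {v e} ⊔ span K (v '' {x | x ∈ E ∧ g x = r}) ≤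
        M ⊔ span K (v '' {x | x ∈ insert e E ∧ Function.update g e r x = r}) := by
      intro M g r
      refine sup_le (sup_le le_sup_left (le_sup_of_le_right (span_mono ?_)))
        (le_sup_of_le_right (span_mono ?_))
      · rintro _ rfl
        exact ⟨e, by simp, rfl⟩
      · apply Set.image_mono
        rintro x ⟨hx, hg⟩
        have : x ≠ e := fun h => he (h ▸ hx)
        simp [hx, hg, this]
    have key' : ∀ (M : Submodule K V) (g : ι → Fin 2) (r s : Fin 2),
        M ⊔ span K (v '' {x | x ∈ E ∧ g x = r}) ≤
        M ⊔ span K (v '' {x | x ∈ insert e E ∧ Function.update g e s x = r}) := by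
      intro M g r s
      refine sup_le le_sup_left (le_sup_of_le_right (span_mono (Set.image_mono ?_)))
      rintro x ⟨hx, hg⟩
      have : x ≠ e := fun h => he (h ▸ hx)
      simp [hx, hg, this]
    rw [Finset.card_insert_of_notMem he]
    rcases extend_left_or_right v he M₀ M₁ h with ⟨hM, hT⟩ | ⟨hM, hT⟩
    · obtain ⟨g, hg⟩ := ih _ _ hT
      refine ⟨Function.update g e 0, ?_⟩
      have h1 := Submodule.finrank_mono (key M₀ g 0)
      have h2 := Submodule.finrank_mono (key' M₁ g 1 0)
      have h3 := finrank_sup_span_singleton_of_notMem hM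
      omega
    · obtain ⟨g, hg⟩ := ih _ _ hT
      refine ⟨Function.update g e 1, ?_⟩
      have h1 := Submodule.finrank_mono (key M₁ g 1)
      have h2 := Submodule.finrank_mono (key' M₀ g 0 1)
      have h3 := finrank_sup_span_singleton_of_notMem hM
      omega

end LinearAlgebra

/-- Specialising polynomial vectors cannot increase the dimension of their span. -/
theorem finrank_span_specialize_le {K R F ι κ : Type*} [Field K] [CommRing R] [IsDomain R]
    [Field F] [Algebra R F] [FaithfulSMul R F] [Algebra K R] [Finite ι] (ev : R →ₐ[K] K)
    (f : κ → ι → R) :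
    finrank K (span K (Set.range fun e => ev ∘ f e)) ≤
      finrank F (span F (Set.range fun e => algebraMap R F ∘ f e)) := by
  classical
  have := Fintype.ofFinite ι
  obtain ⟨σ, s, -, hspan, hind⟩ := exists_linearIndependent' K (fun e => ev ∘ f e)
  have := hind.finite
  have := Fintype.ofFinite σ
  rw [← hspan, finrank_span_eq_card hind]
  have hF : LinearIndependent F (fun e : σ => algebraMap R F ∘ f (s e)) := by
    let M : Matrix σ ι R := Matrix.of fun e => f (s e)
    have hM : LinearIndependent K (M.map ev).row := hind
    have hsurj : Function.Surjective (M.map ev).mulVec := by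
      have h := hM.rank_matrix
      rw [Matrix.rank, ← Module.finrank_fintype_fun_eq_card (R := K)] at h
      exact LinearMap.range_eq_top.1 (Submodule.eq_top_of_finrank_eq h)
    obtain ⟨N, hN⟩ := Matrix.mulVec_surjective_iff_exists_right_inverse.1 hsurj
    have hdet : (M * N.map (algebraMap K R)).det ≠ 0 := by
      intro h0
      have h1 : (M * N.map (algebraMap K R)).map ev = 1 := by
        rw [Matrix.map_mul, Matrix.map_map, ← hN]
        congr 1
        ext i j
        simp
      have h2 := ev.map_det (M * N.map (algebraMap K R))
      rw [h0, map_zero] at h2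
      rw [AlgHom.mapMatrix_apply, h1, Matrix.det_one] at h2
      exact zero_ne_one h2
    have hdet' : IsUnit (M.map (algebraMap R F) *
        (N.map (algebraMap K R)).map (algebraMap R F)) := by
      rw [← Matrix.map_mul, Matrix.isUnit_iff_isUnit_det, isUnit_iff_ne_zero,
        ← RingHom.mapMatrix_apply, ← RingHom.map_det]
      exact (map_ne_zero_iff _ (FaithfulSMul.algebraMap_injective R F)).2 hdet
    have hinj := Matrix.vecMul_injective_iff_isUnit.2 hdet'
    change LinearIndependent F (M.map (algebraMap R F)).row
    rw [← Matrix.vecMul_injective_iff]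
    intro x y hxy
    apply hinj
    dsimp only at hxy ⊢
    rw [← Matrix.vecMul_vecMul, ← Matrix.vecMul_vecMul, hxy]
  rw [← finrank_span_eq_card hF]
  apply Submodule.finrank_mono
  apply span_mono
  rintro _ ⟨e, rfl⟩
  exact ⟨s e, rfl⟩

section GenericSpan

variable {K : Type*} [Field K] {m r : ℕ}

/-- The tensor product of the `c`-th column of `Uᵢ` with the vector `v`. -/
def genericColumn (i : Fin m) (c : Fin 2) (v : Fin r → K) :
    Fin 2 × Fin r → MvPolynomial (Fin m × Fin 2 × Fin 2) K :=
  fun p => MvPolynomial.X (i, p.1, c) * MvPolynomial.C (v p.2)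

/-- The span of all tensor products of columns of the `Uᵢ` with vectors of `L i`. -/
def genericSpan (t : Fin m → ℕ) (L : Fin m → Submodule K (Fin r → K)) :
    Submodule (FF2 K m) (Fin 2 × Fin r → FF2 K m) :=
  span (FF2 K m) (Set.range
    fun e : {e : Fin m × Fin 2 × (Fin r → K) // (e.2.1 : ℕ) < t e.1 ∧ e.2.2 ∈ L e.1} =>
      algebraMap (MvPolynomial (Fin m × Fin 2 × Fin 2) K) (FF2 K m) ∘
        genericColumn e.1.1 e.1.2.1 e.1.2.2)

theorem mem_genericSpan {t : Fin m → ℕ} {L : Fin m → Submodule K (Fin r → K)} {i : Fin m}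
    {c : Fin 2} {v : Fin r → K} (hc : (c : ℕ) < t i) (hv : v ∈ L i) :
    algebraMap (MvPolynomial (Fin m × Fin 2 × Fin 2) K) (FF2 K m) ∘ genericColumn i c v ∈
      genericSpan t L :=
  subset_span ⟨⟨(i, c, v), hc, hv⟩, rfl⟩

theorem genericSpan_mono {t : Fin m → ℕ} {L L' : Fin m → Submodule K (Fin r → K)}
    (h : ∀ i, L i ≤ L' i) : genericSpan t L ≤ genericSpan t L' := by
  refine span_le.2 ?_
  rintro _ ⟨⟨⟨i, c, v⟩, hc, hv⟩, rfl⟩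
  exact mem_genericSpan hc (h i hv)

theorem sum_fin_two_lt {k : ℕ} (hk : k ≤ 2) (x : ℕ) :
    (∑ c : Fin 2, if (c : ℕ) < k then x else 0) = k * x := by
  interval_cases k <;> simp [two_mul]

theorem finrank_add_finrank_le_of_specialization (t : Fin m → ℕ)
    (L : Fin m → Submodule K (Fin r → K)) (γ : Fin m → Fin 2 → Fin 2)
    (N : Fin 2 → Submodule K (Fin r → K))
    (hN : ∀ p, N p ≤ span K {v | ∃ (i : Fin m) (c : Fin 2), (c : ℕ) < t i ∧ γ i c = p ∧ v ∈ L i}) :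
    finrank K (N 0) + finrank K (N 1) ≤ finrank (FF2 K m) (genericSpan t L) := by
  let ev : MvPolynomial (Fin m × Fin 2 × Fin 2) K →ₐ[K] K :=
    MvPolynomial.aeval fun x => if γ x.1 x.2.2 = x.2.1 then 1 else 0
  refine le_trans ?_ (finrank_span_specialize_le (F := FF2 K m) ev
    fun e : {e : Fin m × Fin 2 × (Fin r → K) // (e.2.1 : ℕ) < t e.1 ∧ e.2.2 ∈ L e.1} =>
      genericColumn e.1.1 e.1.2.1 e.1.2.2)
  set Z := span K (Set.range
    fun e : {e : Fin m × Fin 2 × (Fin r → K) // (e.2.1 : ℕ) < t e.1 ∧ e.2.2 ∈ L e.1} =>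
      ev ∘ genericColumn e.1.1 e.1.2.1 e.1.2.2) with hZ
  let emb : Fin 2 → (Fin r → K) →ₗ[K] (Fin 2 × Fin r → K) := fun p =>
    { toFun := fun v q => if p = q.1 then v q.2 else 0
      map_add' := fun v w => by ext q; by_cases h : p = q.1 <;> simp [h]
      map_smul' := fun k v => by ext q; by_cases h : p = q.1 <;> simp [h] }
  have hemb : ∀ p v, v ∈ N p → emb p v ∈ Z := by
    intro p
    suffices h : N p ≤ Z.comap (emb p) from fun v hv => h hv
    refine (hN p).trans (span_le.2 ?_)
    rintro v ⟨i, c, hc, hp, hv⟩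
    refine subset_span ⟨⟨(i, c, v), hc, hv⟩, ?_⟩
    ext q
    simp [ev, genericColumn, emb, hp]
  let F : (N 0 × N 1) →ₗ[K] Z :=
    LinearMap.codRestrict Z
      ((emb 0 ∘ₗ (N 0).subtype).coprod (emb 1 ∘ₗ (N 1).subtype)) fun x => by
        simp only [LinearMap.coprod_apply, LinearMap.comp_apply]
        exact add_mem (hemb _ _ x.1.2) (hemb _ _ x.2.2)
  rw [← Module.finrank_prod]
  refine LinearMap.finrank_le_finrank_of_injective (f := F) ?_
  rw [← LinearMap.ker_eq_bot, LinearMap.ker_eq_bot']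
  rintro ⟨⟨x, hx⟩, ⟨y, hy⟩⟩ h
  have h' : ∀ q, (emb 0 x + emb 1 y) q = 0 := fun q => congrFun (congrArg Subtype.val h) q
  have hx0 : x = 0 := by
    ext j
    simpa [emb] using h' (0, j)
  have hy0 : y = 0 := by
    ext j
    simpa [emb] using h' (1, j)
  subst hx0 hy0
  rfl

open Classical in
/-- The generic span has the expected dimension if no subspace is overfull and at most one of
the subspaces `L i` is not a point. -/
theorem sum_finrank_le_finrank_genericSpan (t : Fin m → ℕ) (ht : ∀ i, t i ≤ 2)
    (L : Fin m → Submodule K (Fin r → K)) (i₀ : Fin m)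
    (hL : ∀ i, i ≠ i₀ → 0 < t i → finrank K (L i) ≤ 1)
    (h : ∀ T : Submodule K (Fin r → K), ∑ i, t i * finrank K ↥(T ⊓ L i) ≤ 2 * finrank K T) :
    ∑ i, t i * finrank K (L i) ≤ finrank (FF2 K m) (genericSpan t L) := by
  have hgen : ∀ i, ∃ v : Fin r → K, finrank K (L i) = 1 → L i = span K {v} ∧ v ≠ 0 := by
    intro i
    by_cases h1 : finrank K (L i) = 1
    · obtain ⟨v, hv0, hv⟩ := finrank_eq_one_iff'.1 h1
      refine ⟨v, fun _ => ⟨le_antisymm (fun w hw => ?_) ?_, fun h => hv0 (Subtype.ext h)⟩⟩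
      · obtain ⟨c, hc⟩ := hv ⟨w, hw⟩
        exact mem_span_singleton.2 ⟨c, congrArg Subtype.val hc⟩
      · simp
    · exact ⟨0, fun h => absurd h h1⟩
  choose v hv using hgen
  let M : Fin 2 → Submodule K (Fin r → K) := fun c => if (c : ℕ) < t i₀ then L i₀ else ⊥
  have hMsum : ∀ T : Submodule K (Fin r → K),
      finrank K ↥(T ⊓ M 0) + finrank K ↥(T ⊓ M 1) = t i₀ * finrank K ↥(T ⊓ L i₀) := by
    intro T
    rw [← sum_fin_two_lt (ht i₀), Fin.sum_univ_two]
    have hM : ∀ c, finrank K ↥(T ⊓ M c) =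
        if (c : ℕ) < t i₀ then finrank K ↥(T ⊓ L i₀) else 0 := by
      intro c
      by_cases hc : (c : ℕ) < t i₀
      · rw [if_pos hc, show M c = L i₀ from if_pos hc]
      · rw [if_neg hc, show M c = ⊥ from if_neg hc, inf_bot_eq, finrank_bot]
    rw [hM, hM]
  let E : Finset (Fin m × Fin 2) := Finset.univ.filter fun e =>
    e.1 ≠ i₀ ∧ (e.2 : ℕ) < t e.1 ∧ finrank K (L e.1) = 1
  have hE : ∀ (T : Submodule K (Fin r → K)), (E.filter fun e => v e.1 ∈ T).card =
      ∑ i ∈ Finset.univ.erase i₀,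
        t i * (if finrank K (L i) = 1 ∧ v i ∈ T then 1 else 0) := by
    intro T
    rw [Finset.filter_filter, Finset.card_filter, Fintype.sum_prod_type,
      ← Finset.sum_erase (a := i₀) _ (by simp)]
    refine Finset.sum_congr rfl fun i hi => ?_
    rw [← sum_fin_two_lt (ht i)]
    refine Finset.sum_congr rfl fun c _ => ?_
    have hi' : i ≠ i₀ := Finset.ne_of_mem_erase hi
    by_cases h1 : (c : ℕ) < t i <;> by_cases h2 : finrank K (L i) = 1 <;>
      by_cases h3 : v i ∈ T <;> simp [hi', h1, h2, h3]
  obtain ⟨g, hg⟩ := exists_partition (fun e : Fin m × Fin 2 => v e.1) E (M 0) (M 1) <| by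
    intro T
    rw [add_assoc, hMsum, hE]
    refine le_trans ?_ (h T)
    rw [← Finset.sum_erase_add _ _ (Finset.mem_univ i₀)]
    gcongr with i hi
    split_ifs with hc
    · have : 0 < finrank K ↥(T ⊓ L i) := by
        rw [Module.finrank_pos_iff_exists_ne_zero]
        obtain ⟨h1, h2⟩ := hv i hc.1
        exact ⟨⟨v i, hc.2, by rw [h1]; exact mem_span_singleton_self _⟩,
          fun h0 => h2 (congrArg Subtype.val h0)⟩
      exact this
    · exact Nat.zero_le _
  have hcard : ∑ i, t i * finrank K (L i) ≤ finrank K (M 0) + finrank K (M 1) + E.card := by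
    have h1 := hMsum ⊤
    have h2 := hE ⊤
    rw [top_inf_eq, top_inf_eq, top_inf_eq] at h1
    simp only [mem_top, Finset.filter_true, and_true] at h2
    rw [h1, h2, ← Finset.sum_erase_add _ _ (Finset.mem_univ i₀), add_comm]
    refine Nat.add_le_add_left (Finset.sum_le_sum fun i hi => ?_) _
    have hi' : i ≠ i₀ := Finset.ne_of_mem_erase hi
    rcases Nat.eq_zero_or_pos (t i) with h0 | h0
    · simp [h0]
    · have := hL i hi' h0
      gcongr
      split_ifs <;> omega
  refine hcard.trans (hg.trans ?_)
  refine finrank_add_finrank_le_of_specialization t L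
    (fun i c => if i = i₀ then c else g (i, c))
    (fun p => M p ⊔ span K ((fun e : Fin m × Fin 2 => v e.1) '' {e | e ∈ E ∧ g e = p})) ?_
  refine fun p => sup_le ?_ (span_mono ?_)
  · simp only [M]
    split_ifs with hp
    · exact fun x hx => subset_span ⟨i₀, p, hp, by simp, hx⟩
    · exact bot_le
  · rintro _ ⟨⟨i, c⟩, ⟨hE, hgp⟩, rfl⟩
    simp only [E, Finset.mem_filter, Finset.mem_univ, true_and] at hE
    refine ⟨i, c, hE.2.1, by simp [hE.1, hgp], ?_⟩
    rw [(hv i hE.2.2).1]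
    exact mem_span_singleton_self _

/-- The dimension of generic spans is superadditive along a linear map. -/
theorem finrank_genericSpan_add_le {n : ℕ} (t : Fin m → ℕ) (φ : (Fin n → K) →ₗ[K] (Fin r → K))
    (L L' : Fin m → Submodule K (Fin n → K)) (hLL : ∀ i, L' i ≤ L i)
    (hker : ∀ i, L' i ≤ LinearMap.ker φ) :
    finrank (FF2 K m) (genericSpan t L') +
      finrank (FF2 K m) (genericSpan t fun i => (L i).map φ) ≤
      finrank (FF2 K m) (genericSpan t L) := by
  let Φ : (Fin 2 × Fin n → FF2 K m) →ₗ[FF2 K m] (Fin 2 × Fin r → FF2 K m) :=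
    Matrix.mulVecLin (Matrix.of fun q p =>
      if q.1 = p.1 then toFF2 K m (LinearMap.toMatrix' φ q.2 p.2) else 0)
  have hΦ : ∀ (i : Fin m) (c : Fin 2) (v : Fin n → K),
      Φ (algebraMap (MvPolynomial (Fin m × Fin 2 × Fin 2) K) (FF2 K m) ∘ genericColumn i c v) =
        algebraMap (MvPolynomial (Fin m × Fin 2 × Fin 2) K) (FF2 K m) ∘
          genericColumn i c (φ v) := by
    intro i c v
    ext q
    have h1 : φ v q.2 = ∑ j, LinearMap.toMatrix' φ q.2 j * v j := by
      conv_lhs => rw [← LinearMap.toMatrix'_mulVec φ v]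
      rfl
    simp only [Φ, Matrix.mulVecLin_apply, Matrix.mulVec, dotProduct, Fintype.sum_prod_type,
      genericColumn, Function.comp_apply, Matrix.of_apply, toFF2, RingHom.comp_apply, h1,
      map_mul, map_sum, Finset.mul_sum, ite_mul, zero_mul]
    rw [Finset.sum_comm]
    refine Finset.sum_congr rfl fun j _ => ?_
    simp only [Finset.sum_ite_eq, Finset.mem_univ, if_true]
    ring
  rw [← finrank_map_add_finrank_inf_ker Φ (genericSpan t L), add_comm]
  gcongr
  · apply Submodule.finrank_mono
    refine span_le.2 ?_
    rintro _ ⟨⟨⟨i, c, w⟩, hc, hw⟩, rfl⟩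
    obtain ⟨v, hv, hvw⟩ := hw
    have hΦv := hΦ i c v
    rw [show φ v = w from hvw] at hΦv
    exact ⟨_, mem_genericSpan hc hv, hΦv⟩
  · apply Submodule.finrank_mono
    refine le_inf (genericSpan_mono hLL) (span_le.2 ?_)
    rintro _ ⟨⟨⟨i, c, v⟩, hc, hv⟩, rfl⟩
    have : φ v = 0 := hker i hv
    simp only [SetLike.mem_coe, LinearMap.mem_ker]
    rw [hΦ, this]
    ext q
    simp [genericColumn]

end GenericSpan

section Tight

variable {K : Type*} [Field K] {m n : ℕ}

/-- The subspace `S` attains equality in the matching inequality for `t / 2`. -/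
def IsTight (t : Fin m → ℕ) (L : Fin m → Submodule K (Fin n → K))
    (S : Submodule K (Fin n → K)) : Prop :=
  ∑ i, t i * finrank K ↥(S ⊓ L i) = 2 * finrank K S

variable {t : Fin m → ℕ} {L : Fin m → Submodule K (Fin n → K)}

theorem isTight_bot : IsTight t L ⊥ := by
  unfold IsTight
  rw [finrank_bot, mul_zero]
  refine Finset.sum_eq_zero fun i _ => ?_
  rw [bot_inf_eq, finrank_bot, mul_zero]

theorem IsTight.uncross
    (hP : ∀ S : Submodule K (Fin n → K), ∑ i, t i * finrank K ↥(S ⊓ L i) ≤ 2 * finrank K S)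
    {S T : Submodule K (Fin n → K)} (hS : IsTight t L S) (hT : IsTight t L T) :
    IsTight t L (S ⊔ T) ∧ IsTight t L (S ⊓ T) ∧ ∀ i, 0 < t i →
      finrank K ↥(S ⊓ L i) + finrank K ↥(T ⊓ L i) =
        finrank K ↥((S ⊔ T) ⊓ L i) + finrank K ↥((S ⊓ T) ⊓ L i) := by
  have h1 := hP (S ⊔ T)
  have h2 := hP (S ⊓ T)
  have h3 := Submodule.finrank_sup_add_finrank_inf_eq S T
  have h4 : ∀ i ∈ Finset.univ, t i * (finrank K ↥(S ⊓ L i) + finrank K ↥(T ⊓ L i)) ≤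
      t i * (finrank K ↥((S ⊔ T) ⊓ L i) + finrank K ↥((S ⊓ T) ⊓ L i)) := fun i _ =>
    Nat.mul_le_mul_left _ (finrank_inf_add_finrank_inf_le S T (L i))
  have h5 := Finset.sum_le_sum h4
  have h6 := Finset.sum_eq_sum_iff_of_le h4
  simp only [mul_add, Finset.sum_add_distrib] at h5 h6
  unfold IsTight at *
  refine ⟨by omega, by omega, fun i hi => ?_⟩
  have h7 := h6.1 (by omega) i (Finset.mem_univ i)
  rw [← mul_add, ← mul_add] at h7
  exact Nat.eq_of_mul_eq_mul_left hi h7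

/-- The dimension bound for generic spans propagates from a tight subspace to a larger subspace
if at most one line gains two dimensions. -/
theorem le_finrank_genericSpan_of_le (ht : ∀ i, t i ≤ 2) (hdim : ∀ i, finrank K (L i) ≤ 2)
    (hP : ∀ S : Submodule K (Fin n → K), ∑ i, t i * finrank K ↥(S ⊓ L i) ≤ 2 * finrank K S)
    {A B : Submodule K (Fin n → K)} (hA : IsTight t L A) (hAB : A ≤ B) (i₀ : Fin m)
    (hloop : ∀ i, i ≠ i₀ → 0 < t i → L i ≤ B → A ⊓ L i ≠ ⊥)
    (ih : ∑ i, t i * finrank K ↥(A ⊓ L i) ≤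
      finrank (FF2 K m) (genericSpan t fun i => A ⊓ L i)) :
    ∑ i, t i * finrank K ↥(B ⊓ L i) ≤
      finrank (FF2 K m) (genericSpan t fun i => B ⊓ L i) := by
  let φ : (Fin n → K) →ₗ[K] (Fin (finrank K ((Fin n → K) ⧸ A)) → K) :=
    (finBasis K ((Fin n → K) ⧸ A)).equivFun.toLinearMap ∘ₗ A.mkQ
  have hker : LinearMap.ker φ = A := by
    rw [LinearEquiv.ker_comp, Submodule.ker_mkQ]
  have hsurj : Function.Surjective φ :=
    (finBasis K ((Fin n → K) ⧸ A)).equivFun.surjective.comp A.mkQ_surjective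
  have hgain : ∀ i, finrank K ↥((B ⊓ L i).map φ) + finrank K ↥(A ⊓ L i) =
      finrank K ↥(B ⊓ L i) := by
    intro i
    rw [← finrank_map_add_finrank_inf_ker φ (B ⊓ L i), hker,
      show B ⊓ L i ⊓ A = A ⊓ L i by rw [inf_right_comm, inf_eq_right.2 hAB]]
  have hlevel := sum_finrank_le_finrank_genericSpan t ht (fun i => (B ⊓ L i).map φ) i₀ ?_ ?_
  · have hadd := finrank_genericSpan_add_le t φ (fun i => B ⊓ L i) (fun i => A ⊓ L i)
      (fun i => inf_le_inf_right _ hAB) (fun i => inf_le_left.trans hker.ge)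
    refine le_trans ?_ hadd
    rw [Finset.sum_congr rfl fun i _ => congrArg (t i * ·) (hgain i).symm]
    simp only [mul_add, Finset.sum_add_distrib]
    omega
  · intro i hi hti
    by_contra! hcon
    have h1 := hgain i
    have h2 := hdim i
    have h3 : finrank K ↥(B ⊓ L i) ≤ finrank K (L i) := Submodule.finrank_mono inf_le_right
    have h4 : finrank K ↥(A ⊓ L i) = 0 := by omega
    have h5 : B ⊓ L i = L i := Submodule.eq_of_le_of_finrank_le inf_le_right (by omega)
    exact hloop i hi hti (inf_eq_right.1 h5) (Submodule.finrank_eq_zero.1 h4)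
  · intro T
    have h1 := hP (T.comap φ)
    have h2 := finrank_map_add_finrank_inf_ker φ (T.comap φ)
    rw [Submodule.map_comap_eq_of_surjective hsurj, hker,
      inf_eq_right.2 (hker.symm.le.trans (LinearMap.ker_le_comap φ))] at h2
    have h3 : ∑ i, t i * (finrank K ↥(T ⊓ (B ⊓ L i).map φ) + finrank K ↥(A ⊓ L i)) ≤
        ∑ i, t i * finrank K ↥(T.comap φ ⊓ L i) := by
      refine Finset.sum_le_sum fun i _ => Nat.mul_le_mul_left _ ?_
      rw [← finrank_map_add_finrank_inf_ker φ (T.comap φ ⊓ L i)]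
      refine add_le_add (Submodule.finrank_mono ?_) (Submodule.finrank_mono ?_)
      · rintro _ ⟨hx, x, hxB, rfl⟩
        exact ⟨x, ⟨hx, hxB.2⟩, rfl⟩
      · rintro x ⟨hxA, hxL⟩
        rw [← hker] at hxA
        exact ⟨⟨LinearMap.ker_le_comap φ hxA, hxL⟩, hxA⟩
    simp only [mul_add, Finset.sum_add_distrib] at h3
    unfold IsTight at hA
    omega

/-- Two lines that both appear in full between consecutive tight subspaces have the same
intersection numbers with all tight subspaces. -/
theorem finrank_inf_eq_of_consecutive
    (hP : ∀ S : Submodule K (Fin n → K), ∑ i, t i * finrank K ↥(S ⊓ L i) ≤ 2 * finrank K S)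
    {A B : Submodule K (Fin n → K)} (hA : IsTight t L A) (hB : IsTight t L B) (hAB : A ≤ B)
    (hcons : ∀ S, IsTight t L S → A ≤ S → S ≤ B → S = A ∨ S = B)
    {i j : Fin m} (hi : 0 < t i) (hj : 0 < t j) (hiB : L i ≤ B) (hjB : L j ≤ B)
    (hiA : A ⊓ L i = ⊥) (hjA : A ⊓ L j = ⊥) (hij : finrank K (L i) = finrank K (L j))
    {T : Submodule K (Fin n → K)} (hT : IsTight t L T) :
    finrank K ↥(T ⊓ L i) = finrank K ↥(T ⊓ L j) := by
  obtain ⟨hU, -, h1⟩ := hA.uncross hP hT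
  obtain ⟨-, hI, h2⟩ := hU.uncross hP hB
  have key : ∀ k, 0 < t k → L k ≤ B → A ⊓ L k = ⊥ →
      finrank K ↥(T ⊓ L k) = finrank K ↥(((A ⊔ T) ⊓ B) ⊓ L k) := by
    intro k hk hkB hkA
    have e1 := h1 k hk
    have e2 := h2 k hk
    have e3 : (A ⊓ T) ⊓ L k = ⊥ := le_bot_iff.1 (hkA ▸ inf_le_inf_right _ inf_le_left)
    rw [hkA, e3, finrank_bot] at e1
    rw [inf_eq_right.2 hkB, inf_eq_right.2 (hkB.trans le_sup_right)] at e2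
    omega
  rw [key i hi hiB hiA, key j hj hjB hjA]
  rcases hcons _ hI (le_inf le_sup_left hAB) inf_le_right with h | h
  · rw [h, hiA, hjA]
  · rw [h, inf_eq_right.2 hiB, inf_eq_right.2 hjB, hij]

theorem finrank_inf_eq_zero_of_maximal
    (hP : ∀ S : Submodule K (Fin n → K), ∑ i, t i * finrank K ↥(S ⊓ L i) ≤ 2 * finrank K S)
    {A : Submodule K (Fin n → K)} (hA : IsTight t L A)
    (hmax : ∀ S, IsTight t L S → A ≤ S → S = A) {i : Fin m} (hiA : A ⊓ L i = ⊥)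
    {T : Submodule K (Fin n → K)} (hT : IsTight t L T) : finrank K ↥(T ⊓ L i) = 0 := by
  have h := hmax _ (hA.uncross hP hT).1 le_sup_left
  rw [Submodule.finrank_eq_zero, ← le_bot_iff, ← hiA]
  exact inf_le_inf_right _ (sup_eq_left.1 h)

end Tight

section Extreme

variable {K : Type*} [Field K] {m n : ℕ}

theorem finrank_line {a b : Fin n → K} (h : LinearIndependent K ![a, b]) :
    finrank K (line a b) = 2 := by
  have := finrank_span_eq_card h
  rwa [Matrix.range_cons_cons_empty] at this

theorem isFracMatching_half_iff {a b : Fin m → Fin n → K} {t : Fin m → ℕ} :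
    IsFracMatching a b (fun i => (t i : ℝ) / 2) ↔ ∀ S : Submodule K (Fin n → K),
      ∑ i, t i * finrank K ↥(S ⊓ line (a i) (b i)) ≤ 2 * finrank K S := by
  have h : ∀ S : Submodule K (Fin n → K),
      (∑ i, (finrank K ↥(S ⊓ line (a i) (b i)) : ℝ) * ((t i : ℝ) / 2) ≤ (finrank K S : ℝ)) ↔
      ∑ i, t i * finrank K ↥(S ⊓ line (a i) (b i)) ≤ 2 * finrank K S := by
    intro S
    rw [← Nat.cast_le (α := ℝ)]
    push_cast
    have : ∑ i, (finrank K ↥(S ⊓ line (a i) (b i)) : ℝ) * ((t i : ℝ) / 2) =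
        (∑ i, (t i : ℝ) * (finrank K ↥(S ⊓ line (a i) (b i)) : ℝ)) / 2 := by
      rw [Finset.sum_div]
      exact Finset.sum_congr rfl fun i _ => by ring
    rw [this, div_le_iff₀ two_pos, mul_comm (2 : ℝ)]
  simp only [IsFracMatching, h]
  exact ⟨fun h => h.2, fun h => ⟨fun i => by positivity, h⟩⟩

/-- An extreme point admits no nonzero small integral direction that is orthogonal to all tight
constraints. -/
theorem eq_zero_of_extremePoint {a b : Fin m → Fin n → K} {t : Fin m → ℕ}
    (hext : (fun i => (t i : ℝ) / 2) ∈
      Set.extremePoints ℝ {y : Fin m → ℝ | IsFracMatching a b y})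
    (d : Fin m → ℝ) (hd : ∀ i, |d i| ≤ t i)
    (hsmall : ∀ S : Submodule K (Fin n → K),
      |∑ i, (finrank K ↥(S ⊓ line (a i) (b i)) : ℝ) * d i| ≤ 2)
    (htight : ∀ S, IsTight t (fun i => line (a i) (b i)) S →
      ∑ i, (finrank K ↥(S ⊓ line (a i) (b i)) : ℝ) * d i = 0) : d = 0 := by
  have hP := isFracMatching_half_iff.1 hext.1
  have key : ∀ e : Fin m → ℝ, (∀ i, |e i| ≤ t i) → (∀ S : Submodule K (Fin n → K),
      |∑ i, (finrank K ↥(S ⊓ line (a i) (b i)) : ℝ) * e i| ≤ 2) →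
      (∀ S, IsTight t (fun i => line (a i) (b i)) S →
        ∑ i, (finrank K ↥(S ⊓ line (a i) (b i)) : ℝ) * e i = 0) →
      IsFracMatching a b (fun i => (t i : ℝ) / 2 + e i / 4) := by
    intro e h1 h2 h3
    refine ⟨fun i => ?_, fun S => ?_⟩
    · have := (abs_le.1 (h1 i)).1
      have h0 : (0 : ℝ) ≤ t i := Nat.cast_nonneg _
      dsimp only
      linarith
    · have hsum : ∑ i, (finrank K ↥(S ⊓ line (a i) (b i)) : ℝ) * ((t i : ℝ) / 2 + e i / 4) =
          (∑ i, (t i : ℝ) * (finrank K ↥(S ⊓ line (a i) (b i)) : ℝ)) / 2 +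
          (∑ i, (finrank K ↥(S ⊓ line (a i) (b i)) : ℝ) * e i) / 4 := by
        rw [Finset.sum_div, Finset.sum_div, ← Finset.sum_add_distrib]
        exact Finset.sum_congr rfl fun i _ => by ring
      rw [hsum]
      by_cases hS : IsTight t (fun i => line (a i) (b i)) S
      · rw [h3 S hS]
        unfold IsTight at hS
        have hS' : (∑ i, (t i : ℝ) * (finrank K ↥(S ⊓ line (a i) (b i)) : ℝ)) =
            2 * (finrank K S : ℝ) := by exact_mod_cast hS
        rw [hS']
        linarith
      · have hlt := lt_of_le_of_ne (hP S) hS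
        have hlt' : (∑ i, (t i : ℝ) * (finrank K ↥(S ⊓ line (a i) (b i)) : ℝ)) + 1 ≤
            2 * (finrank K S : ℝ) := by exact_mod_cast hlt
        have := (abs_le.1 (h2 S)).2
        linarith
  have hplus := key d hd hsmall htight
  have hminus := key (-d) (by simpa using hd)
    (by simpa only [Pi.neg_apply, mul_neg, Finset.sum_neg_distrib, abs_neg] using hsmall)
    (by simpa only [Pi.neg_apply, mul_neg, Finset.sum_neg_distrib, neg_eq_zero] using htight)
  have hseg := hext.2 hplus hminus ⟨1 / 2, 1 / 2, by norm_num, by norm_num, by norm_num, by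
    ext i
    simp only [Pi.add_apply, Pi.smul_apply, smul_eq_mul, Pi.neg_apply]
    ring⟩
  ext i
  have : (t i : ℝ) / 2 + d i / 4 = (t i : ℝ) / 2 := congrFun hseg i
  rw [Pi.zero_apply]
  linarith

theorem sum_mul_single {ι : Type*} [Fintype ι] [DecidableEq ι] (f : ι → ℝ) (i : ι) :
    ∑ j, f j * (Pi.single i 1 : ι → ℝ) j = f i := by
  simp [Pi.single_apply]

theorem finrank_inf_line_le {a b : Fin n → K} (h : LinearIndependent K ![a, b])
    (S : Submodule K (Fin n → K)) : (finrank K ↥(S ⊓ line a b) : ℝ) ≤ 2 := by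
  rw [← Nat.cast_ofNat, ← finrank_line h]
  exact_mod_cast Submodule.finrank_mono inf_le_right

theorem abs_single_le {t : Fin m → ℕ} {i : Fin m} (hi : 0 < t i) (j : Fin m) :
    |(Pi.single i 1 : Fin m → ℝ) j| ≤ t j := by
  rcases eq_or_ne j i with rfl | hj
  · simpa using Nat.one_le_cast (α := ℝ).2 hi
  · simp [hj]

/-- No line in the support has zero intersection with all tight subspaces. -/
theorem exists_isTight_finrank_inf_ne_zero {a b : Fin m → Fin n → K}
    (hab : ∀ i, LinearIndependent K ![a i, b i]) {t : Fin m → ℕ}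
    (hext : (fun i => (t i : ℝ) / 2) ∈
      Set.extremePoints ℝ {y : Fin m → ℝ | IsFracMatching a b y})
    {i : Fin m} (hi : 0 < t i) :
    ∃ T, IsTight t (fun i => line (a i) (b i)) T ∧ finrank K ↥(T ⊓ line (a i) (b i)) ≠ 0 := by
  by_contra! hcon
  have h := eq_zero_of_extremePoint hext (Pi.single i 1) (abs_single_le hi) (fun S => by
      rw [sum_mul_single, abs_of_nonneg (Nat.cast_nonneg _)]
      exact finrank_inf_line_le (hab i) S) (fun S hS => by
      rw [sum_mul_single, hcon S hS, Nat.cast_zero])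
  simpa using congrFun h i

/-- Distinct lines in the support are separated by tight subspaces. -/
theorem exists_isTight_finrank_inf_ne {a b : Fin m → Fin n → K}
    (hab : ∀ i, LinearIndependent K ![a i, b i]) {t : Fin m → ℕ}
    (hext : (fun i => (t i : ℝ) / 2) ∈
      Set.extremePoints ℝ {y : Fin m → ℝ | IsFracMatching a b y})
    {i j : Fin m} (hij : i ≠ j) (hi : 0 < t i) (hj : 0 < t j) :
    ∃ T, IsTight t (fun i => line (a i) (b i)) T ∧
      finrank K ↥(T ⊓ line (a i) (b i)) ≠ finrank K ↥(T ⊓ line (a j) (b j)) := by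
  by_contra! hcon
  have h := eq_zero_of_extremePoint hext (Pi.single i 1 - Pi.single j 1) (fun k => by
      rcases eq_or_ne k i with rfl | hk
      · simpa [hij] using Nat.one_le_cast (α := ℝ).2 hi
      · simpa [hk] using abs_single_le hj k) (fun S => by
      simp only [Pi.sub_apply, mul_sub, Finset.sum_sub_distrib, sum_mul_single]
      have h1 := finrank_inf_line_le (hab i) S
      have h2 := finrank_inf_line_le (hab j) S
      have h3 : (0 : ℝ) ≤ finrank K ↥(S ⊓ line (a i) (b i)) := Nat.cast_nonneg _
      have h4 : (0 : ℝ) ≤ finrank K ↥(S ⊓ line (a j) (b j)) := Nat.cast_nonneg _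
      rw [abs_le]
      constructor <;> linarith) (fun S hS => by
      simp only [Pi.sub_apply, mul_sub, Finset.sum_sub_distrib, sum_mul_single]
      rw [hcon S hS, sub_self])
  simpa [hij] using congrFun h i

theorem le_finrank_genericSpan_of_isTight {a b : Fin m → Fin n → K}
    (hab : ∀ i, LinearIndependent K ![a i, b i]) {t : Fin m → ℕ} (ht : ∀ i, t i ≤ 2) (hm : 0 < m)
    (hext : (fun i => (t i : ℝ) / 2) ∈
      Set.extremePoints ℝ {y : Fin m → ℝ | IsFracMatching a b y})
    (B : Submodule K (Fin n → K)) (hB : IsTight t (fun i => line (a i) (b i)) B) :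
    ∑ i, t i * finrank K ↥(B ⊓ line (a i) (b i)) ≤
      finrank (FF2 K m) (genericSpan t fun i => B ⊓ line (a i) (b i)) := by
  have hP := isFracMatching_half_iff.1 hext.1
  induction B using WellFoundedLT.induction with
  | ind B ih =>
    rcases eq_or_ne B ⊥ with rfl | hB0
    · refine le_of_eq_of_le (Finset.sum_eq_zero fun i _ => ?_) (Nat.zero_le _)
      rw [bot_inf_eq, finrank_bot, mul_zero]
    · obtain ⟨A, ⟨hA, hAB⟩, hmax⟩ := wellFounded_gt.has_min
        {S | IsTight t (fun i => line (a i) (b i)) S ∧ S < B} ⟨⊥, isTight_bot, hB0.bot_lt⟩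
      have hcons : ∀ S, IsTight t (fun i => line (a i) (b i)) S → A ≤ S → S ≤ B →
          S = A ∨ S = B := by
        intro S hS hAS hSB
        by_contra! hcon
        exact hmax S ⟨hS, lt_of_le_of_ne hSB hcon.2⟩ (lt_of_le_of_ne hAS hcon.1.symm)
      obtain ⟨i₀, hi₀⟩ : ∃ i₀ : Fin m, ∀ i, i ≠ i₀ → 0 < t i → line (a i) (b i) ≤ B →
          A ⊓ line (a i) (b i) ≠ ⊥ := by
        by_cases hex : ∃ i₀, 0 < t i₀ ∧ line (a i₀) (b i₀) ≤ B ∧ A ⊓ line (a i₀) (b i₀) = ⊥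
        · obtain ⟨i₀, h0, h1, h2⟩ := hex
          refine ⟨i₀, fun i hi hti hiB hiA => ?_⟩
          obtain ⟨T, hT, hne⟩ := exists_isTight_finrank_inf_ne hab hext hi hti h0
          exact hne (finrank_inf_eq_of_consecutive (L := fun i => line (a i) (b i)) hP hA hB
            hAB.le hcons hti h0 hiB h1 hiA h2
            ((finrank_line (hab i)).trans (finrank_line (hab i₀)).symm) hT)
        · push Not at hex
          exact ⟨⟨0, hm⟩, fun i _ => hex i⟩
      exact le_finrank_genericSpan_of_le ht (fun i => (finrank_line (hab i)).le) hP hA hAB.le i₀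
        hi₀ (ih A hAB hA)

theorem sum_two_mul_le_finrank_genericSpan {a b : Fin m → Fin n → K}
    (hab : ∀ i, LinearIndependent K ![a i, b i]) {t : Fin m → ℕ} (ht : ∀ i, t i ≤ 2) (hm : 0 < m)
    (hext : (fun i => (t i : ℝ) / 2) ∈
      Set.extremePoints ℝ {y : Fin m → ℝ | IsFracMatching a b y}) :
    ∑ i, 2 * t i ≤ finrank (FF2 K m) (genericSpan t fun i => line (a i) (b i)) := by
  have hP := isFracMatching_half_iff.1 hext.1
  obtain ⟨A, hA, hmax⟩ := wellFounded_gt.has_min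
    {S | IsTight t (fun i => line (a i) (b i)) S} ⟨⊥, isTight_bot⟩
  have hmax' : ∀ S, IsTight t (fun i => line (a i) (b i)) S → A ≤ S → S = A :=
    fun S hS hAS => by_contra fun hne => hmax S hS (lt_of_le_of_ne hAS (Ne.symm hne))
  have h := le_finrank_genericSpan_of_le ht (fun i => (finrank_line (hab i)).le) hP hA le_top
    ⟨0, hm⟩ (fun i _ hti _ hiA => by
      obtain ⟨T, hT, hne⟩ := exists_isTight_finrank_inf_ne_zero hab hext hti
      exact hne (finrank_inf_eq_zero_of_maximal (L := fun i => line (a i) (b i)) hP hA hmax'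
        hiA hT))
    (le_finrank_genericSpan_of_isTight hab ht hm hext A hA)
  refine le_trans (le_of_eq (Finset.sum_congr rfl fun i _ => ?_))
    (h.trans (Submodule.finrank_mono (genericSpan_mono fun i => inf_le_right)))
  rw [top_inf_eq, finrank_line (hab i), mul_comm]

end Extreme

section Columns

variable {K : Type*} [Field K] {m n : ℕ}

theorem genericSpan_line_le_span_col (a b : Fin m → Fin n → K) (t : Fin m → ℕ) :
    genericSpan t (fun i => line (a i) (b i)) ≤
      span (FF2 K m) (Set.range (Bmat a b t).col) := by
  refine span_le.2 ?_
  rintro _ ⟨⟨⟨i, c, v⟩, hc, hv⟩, rfl⟩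
  obtain ⟨x, y, hxy⟩ := mem_span_pair.1 hv
  have h : algebraMap (MvPolynomial (Fin m × Fin 2 × Fin 2) K) (FF2 K m) ∘
      genericColumn i c v =
      toFF2 K m x • (Bmat a b t).col (i, c, 0) + toFF2 K m y • (Bmat a b t).col (i, c, 1) := by
    ext p
    rw [← show x • a i + y • b i = v from hxy]
    simp only [Function.comp_apply, genericColumn, Bmat, Matrix.col_apply, Matrix.of_apply,
      Pi.add_apply, Pi.smul_apply, smul_eq_mul, colMat, Uvar, toFF2, RingHom.comp_apply, map_add,
      map_mul, if_pos (show (c : ℕ) < t i from hc), if_true, one_ne_zero, if_false]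
    ring
  exact h.symm.subst (motive := (· ∈ span _ (Set.range (Bmat a b t).col)))
    (add_mem (smul_mem _ _ (subset_span ⟨_, rfl⟩)) (smul_mem _ _ (subset_span ⟨_, rfl⟩)))

theorem rank_Bmat_le (a b : Fin m → Fin n → K) {t : Fin m → ℕ} (ht : ∀ i, t i ≤ 2) :
    (Bmat a b t).rank ≤ ∑ i, 2 * t i := by
  classical
  let s : Finset (Fin m × Fin 2 × Fin 2) := Finset.univ.filter fun e => (e.2.1 : ℕ) < t e.1
  have hs : s.card = ∑ i, 2 * t i := by
    simp only [s, Finset.card_filter, Fintype.sum_prod_type]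
    refine Finset.sum_congr rfl fun i _ => ?_
    rw [Finset.sum_comm]
    simp [sum_fin_two_lt (ht i)]
  rw [Matrix.rank_eq_finrank_span_cols, ← hs]
  have hle : span (FF2 K m) (Set.range (Bmat a b t).col) ≤
      span (FF2 K m) (s.image (Bmat a b t).col : Set _) := by
    refine span_le.2 ?_
    rintro _ ⟨e, rfl⟩
    by_cases he : (e.2.1 : ℕ) < t e.1
    · exact subset_span (by
        rw [Finset.coe_image]
        exact ⟨e, by simpa [s] using he, rfl⟩)
    · have : (Bmat a b t).col e = 0 := by
        ext p
        simp [Bmat, he]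
      rw [this]
      exact zero_mem _
  exact (Submodule.finrank_mono hle).trans
    ((finrank_span_finset_le_card _).trans Finset.card_image_le)

end Columns

/-- If the half-integral vector `y` (encoded by `t : Fin m → ℕ`, `yᵢ = tᵢ / 2`) is an
extreme point of the fractional matroid parity polytope, then `B(y)` has full column rank. -/
theorem fullColumnRank_of_extremePoint
    {K : Type*} [Field K] {n m : ℕ} (hn : 0 < n) (hm : 0 < m)
    (a b : Fin m → Fin n → K) (hab : ∀ i, LinearIndependent K ![a i, b i])
    (t : Fin m → ℕ) (ht : ∀ i, t i ≤ 2)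
    (hext : (fun i => (t i : ℝ) / 2) ∈
      Set.extremePoints ℝ {y : Fin m → ℝ | IsFracMatching a b y}) :
    (Bmat a b t).rank = ∑ i, 2 * t i := by
  refine le_antisymm (rank_Bmat_le a b ht) ?_
  rw [Matrix.rank_eq_finrank_span_cols]
  exact (sum_two_mul_le_finrank_genericSpan hab ht hm hext).trans
    (Submodule.finrank_mono (genericSpan_line_le_span_col a b t))
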